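/- Let U ⊆ ℝ^N be open, let g_1, ..., g_N : U → ℝ be smooth nowhere-vanishing functions defining the diagonal covariant metric g_{ij}(u) = g_i(u) δ_{ij} (with contravariant metric g^{ij}(u) = δ^{ij}/g_i(u)), and let V^1, ..., V^N : U → ℝ be smooth, defining the diagonal affinor V^i_j(u) = V^i(u) δ^i_j. Then ∇_j V^i_k = ∇_k V^i_j holds on U for all i, j, k if and only if ∂V^i/∂u^j = ( (∂g_i/∂u^j) / (2 g_i) ) (V^j − V^i) holds on U for all i ≠ j. -/

import Mathlib

/-- Partial derivative `∂f/∂u^j` of a scalar function on `ℝ^N`. -/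
noncomputable def pd {N : ℕ} (f : (Fin N → ℝ) → ℝ) (j : Fin N) (u : Fin N → ℝ) : ℝ :=
  fderiv ℝ f u (Pi.single j 1)

/-- Christoffel symbols `Γ^i_{jk}` built from a covariant metric `gco` and its (contravariant)
inverse `gcon`. -/
noncomputable def christoffelCov {N : ℕ}
    (gco gcon : (Fin N → ℝ) → Matrix (Fin N) (Fin N) ℝ) (i j k : Fin N) (u : Fin N → ℝ) : ℝ :=
  (1 / 2) * ∑ s, gcon u i s *
    (pd (fun v => gco v s k) j u + pd (fun v => gco v j s) k u - pd (fun v => gco v j k) s u)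

/-- Covariant derivative `∇_j V^i_k` of an affinor `V` for the connection with Christoffel
symbols coming from the covariant metric `gco` with inverse `gcon`. -/
noncomputable def covDerivCov {N : ℕ}
    (gco gcon V : (Fin N → ℝ) → Matrix (Fin N) (Fin N) ℝ) (j i k : Fin N) (u : Fin N → ℝ) : ℝ :=
  pd (fun w => V w i k) j u +
    ∑ s, (christoffelCov gco gcon i j s u * V u s k - christoffelCov gco gcon s j k u * V u i s)

theorem pd_diag_aux {N : ℕ} (g : Fin N → (Fin N → ℝ) → ℝ) (a b j : Fin N) (u : Fin N → ℝ) :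
    pd (fun v => (Matrix.diagonal fun s => g s v) a b) j u = if a = b then pd (g a) j u else 0 := by
  by_cases h : a = b
  · subst h
    simp
  · simp [h, pd, Matrix.diagonal_apply_ne]

theorem chr_diag_aux {N : ℕ} (g : Fin N → (Fin N → ℝ) → ℝ) (i j k : Fin N) (u : Fin N → ℝ) :
    christoffelCov (fun v => Matrix.diagonal fun s => g s v)
      (fun v => Matrix.diagonal fun s => (g s v)⁻¹) i j k u =
    (1 / 2) * ((g i u)⁻¹ * ((if i = k then pd (g i) j u else 0) +
      (if j = i then pd (g j) k u else 0) - (if j = k then pd (g j) i u else 0))) := by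
  unfold christoffelCov
  simp only [pd_diag_aux]
  rw [Finset.sum_eq_single i]
  · simp
  · intro b _ hb
    simp [Matrix.diagonal_apply_ne _ hb.symm]
  · simp

theorem cov_diag_aux {N : ℕ} (g V : Fin N → (Fin N → ℝ) → ℝ) (i j k : Fin N) (u : Fin N → ℝ) :
    covDerivCov (fun v => Matrix.diagonal fun s => g s v)
      (fun v => Matrix.diagonal fun s => (g s v)⁻¹)
      (fun v => Matrix.diagonal fun s => V s v) j i k u =
    (if i = k then pd (V i) j u else 0) +
    (1 / 2) * ((g i u)⁻¹ * ((if i = k then pd (g i) j u else 0) +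
      (if j = i then pd (g j) k u else 0) - (if j = k then pd (g j) i u else 0))) *
      (V k u - V i u) := by
  unfold covDerivCov
  rw [pd_diag_aux, Finset.sum_sub_distrib, Finset.sum_eq_single k, Finset.sum_eq_single i,
    chr_diag_aux]
  · simp only [Matrix.diagonal_apply_eq]
    ring
  · intro b _ hb
    simp [Matrix.diagonal_apply_ne _ hb.symm]
  · simp
  · intro b _ hb
    simp [Matrix.diagonal_apply_ne _ hb]
  · simp

/-- For a diagonal covariant metric `g_{ij} = g_i δ_{ij}` and a diagonal affinor
`V^i_j = V^i δ^i_j`, the symmetry `∇_j V^i_k = ∇_k V^i_j` of the covariant derivative holds on `U`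
iff `∂V^i/∂u^j = ((∂g_i/∂u^j)/(2 g_i)) (V^j − V^i)` holds on `U` for all `i ≠ j`. -/
theorem diagonal_covDeriv_symmetric_iff {N : ℕ}
    (U : Set (Fin N → ℝ)) (hU : IsOpen U)
    (g : Fin N → (Fin N → ℝ) → ℝ)
    (hgsm : ∀ i, ContDiffOn ℝ (⊤ : ℕ∞) (g i) U)
    (hg0 : ∀ i, ∀ u ∈ U, g i u ≠ 0)
    (V : Fin N → (Fin N → ℝ) → ℝ)
    (hVsm : ∀ i, ContDiffOn ℝ (⊤ : ℕ∞) (V i) U) :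
    (∀ u ∈ U, ∀ i j k : Fin N,
        covDerivCov (fun v => Matrix.diagonal fun s => g s v)
          (fun v => Matrix.diagonal fun s => (g s v)⁻¹)
          (fun v => Matrix.diagonal fun s => V s v) j i k u =
        covDerivCov (fun v => Matrix.diagonal fun s => g s v)
          (fun v => Matrix.diagonal fun s => (g s v)⁻¹)
          (fun v => Matrix.diagonal fun s => V s v) k i j u) ↔
      (∀ u ∈ U, ∀ i j : Fin N, i ≠ j →
        pd (V i) j u = (pd (g i) j u / (2 * g i u)) * (V j u - V i u)) := by
  simp only [cov_diag_aux]
  constructor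
  · intro H u hu i j hij
    have h := H u hu i j i
    have h0 := hg0 i u hu
    simp only [hij, hij.symm, if_true, if_false] at h
    field_simp at h ⊢
    linarith
  · intro H u hu i j k
    by_cases hjk : j = k
    · subst hjk; rfl
    by_cases hik : i = k
    · subst hik
      have h := H u hu i j (Ne.symm hjk)
      have h0 := hg0 i u hu
      simp only [hjk, Ne.symm hjk, if_true, if_false, h]
      field_simp
      ring
    by_cases hij : i = j
    · subst hij
      have h := H u hu i k hik
      have h0 := hg0 i u hu
      simp only [hik, Ne.symm hik, if_true, if_false, h]
      field_simp
      ring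
    · simp [hij, hik, hjk, Ne.symm hij, Ne.symm hik, Ne.symm hjk]
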